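/- Assume either n ≡ 7 (mod 12) and p does not divide (n+1)/4, or n ≡ 1 (mod 12) and p does not divide (n−1)/4. Set Δ₁ = (n₁+1)/2 mod p, Δ₂ = (n₂−1)/2 mod p, and Δ = (n₁+1)(n₂−1)/2 mod p. Then g_λ(x) = (x^n−1)/gcd(x^n−1, Λ(x)) in GF(q)[x] is given by: g_λ(x) = x^n−1 if Δ₁ ≠ 0, Δ₂ ≠ 0 and Δ ≠ 0; g_λ(x) = (x^n−1)/(x−1) if Δ₁ ≠ 0, Δ₂ ≠ 0 and Δ = 0; g_λ(x) = (x^n−1)/(x^{n₂}−1) if Δ₁ = 0 and Δ₂ ≠ 0; g_λ(x) = (x^n−1)/(x^{n₁}−1) if Δ₁ ≠ 0 and Δ₂ = 0; and g_λ(x) = (x^n−1)(x−1)/((x^{n₁}−1)(x^{n₂}−1)) if Δ₁ = Δ₂ = 0. Correspondingly, the linear complexity L_λ = n − deg gcd(x^n−1, Λ(x)) equals n, n−1, n−n₂, n−n₁ and n−(n₁+n₂−1) in the respective cases. -/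

import Mathlib

open Polynomial

/-- The sum of the powers `z ^ a` over the residues `a` modulo `ℓ` of quadratic character `ε`. -/
def residueSum (ℓ : ℕ) [Fact ℓ.Prime] (ε : ℤ) {R : Type*} [CommRing R] (z : R) : R :=
  ∑ a : ZMod ℓ with quadraticChar (ZMod ℓ) a = ε, z ^ a.val

section ResidueSums

variable {ℓ : ℕ} [Fact ℓ.Prime] {R : Type*} [CommRing R]

lemma residueSum_add (z : R) :
    residueSum ℓ 1 z + residueSum ℓ (-1) z + 1 = ∑ a : ZMod ℓ, z ^ a.val := by
  have key : ∀ a : ZMod ℓ, z ^ a.val = (if quadraticChar (ZMod ℓ) a = 1 then z ^ a.val else 0)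
      + (if quadraticChar (ZMod ℓ) a = -1 then z ^ a.val else 0) + if a = 0 then 1 else 0 := by
    intro a
    by_cases ha : a = 0
    · simp [ha]
    · rcases quadraticChar_dichotomy ha with h | h <;> simp [h, ha]
  rw [Finset.sum_congr rfl fun a _ => key a]
  simp [residueSum, Finset.sum_add_distrib, Finset.sum_filter]

lemma residueSum_sub (z : R) :
    residueSum ℓ 1 z - residueSum ℓ (-1) z
      = ∑ a : ZMod ℓ, (quadraticChar (ZMod ℓ) a : R) * z ^ a.val := by
  rw [residueSum, residueSum, Finset.sum_filter, Finset.sum_filter, ← Finset.sum_sub_distrib]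
  refine Finset.sum_congr rfl fun a _ => ?_
  by_cases ha : a = 0
  · simp [ha]
  · rcases quadraticChar_dichotomy ha with h | h <;> simp [h]

lemma sum_zmod_pow_val (n : ℕ) [NeZero n] (z : R) :
    ∑ a : ZMod n, z ^ a.val = ∑ i ∈ Finset.range n, z ^ i := by
  obtain ⟨m, rfl⟩ := Nat.exists_eq_succ_of_ne_zero (NeZero.ne n)
  exact Fin.sum_univ_eq_sum_range (fun i => z ^ i) (m + 1)

lemma residueSum_add_of_ne_one [IsDomain R] {z : R} (hz : z ^ ℓ = 1) (hz1 : z ≠ 1) :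
    residueSum ℓ 1 z + residueSum ℓ (-1) z = -1 := by
  have h := residueSum_add (ℓ := ℓ) z
  rw [sum_zmod_pow_val] at h
  have h0 : ∑ i ∈ Finset.range ℓ, z ^ i = 0 := by
    have := geom_sum_mul z ℓ
    rw [hz, sub_self] at this
    exact (mul_eq_zero.mp this).resolve_right (sub_ne_zero.mpr hz1)
  linear_combination h + h0

lemma residueSum_one (hℓ : ℓ ≠ 2) {ε : ℤ} (hε : ε = 1 ∨ ε = -1) :
    residueSum ℓ ε (1 : R) = ((ℓ - 1) / 2 : ℕ) := by
  have hsum := residueSum_add (ℓ := ℓ) (1 : ℤ)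
  have hdiff := residueSum_sub (ℓ := ℓ) (1 : ℤ)
  have h0 : ∑ a : ZMod ℓ, quadraticChar (ZMod ℓ) a = 0 :=
    quadraticChar_sum_zero (by rwa [ZMod.ringChar_zmod_n])
  simp only [Int.cast_id, one_pow, mul_one, h0, Finset.sum_const, Finset.card_univ, ZMod.card,
    nsmul_eq_mul] at hsum hdiff
  have hcard : ∀ δ : ℤ, residueSum ℓ δ (1 : ℤ)
      = (Finset.univ.filter fun a : ZMod ℓ => quadraticChar (ZMod ℓ) a = δ).card := by
    simp [residueSum]
  rw [hcard, hcard] at hsum hdiff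
  have : (Finset.univ.filter fun a : ZMod ℓ => quadraticChar (ZMod ℓ) a = ε).card = (ℓ - 1) / 2 := by
    rcases hε with rfl | rfl <;> omega
  simp only [residueSum, one_pow, Finset.sum_const, this, nsmul_eq_mul, mul_one]

lemma four_mul_residueSum_mul (hℓ : ℓ ≠ 2) {ζ : ℂ} (hζ : IsPrimitiveRoot ζ ℓ) :
    4 * (residueSum ℓ 1 ζ * residueSum ℓ (-1) ζ) = 1 - (ZMod.χ₄ ℓ : ℂ) * ℓ := by
  have hp : ℓ.Prime := Fact.out
  have hadd := residueSum_add_of_ne_one hζ.pow_eq_one (hζ.ne_one hp.one_lt)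
  have hsub := residueSum_sub (ℓ := ℓ) ζ
  have hchar : ringChar (ZMod ℓ) ≠ 2 := by rwa [ZMod.ringChar_zmod_n]
  have hψ := AddChar.zmodChar_primitive_of_primitive_root ℓ hζ
  have hχ : (quadraticChar (ZMod ℓ)).ringHomComp (Int.castRingHom ℂ) ≠ 1 := by
    rw [Ne, MulChar.ringHomComp_eq_one_iff Int.cast_injective]
    exact quadraticChar_ne_one hchar
  have hsq := gaussSum_sq hχ ((quadraticChar_isQuadratic (ZMod ℓ)).comp _) hψ
  have hG : gaussSum ((quadraticChar (ZMod ℓ)).ringHomComp (Int.castRingHom ℂ))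
      (AddChar.zmodChar ℓ hζ.pow_eq_one) = residueSum ℓ 1 ζ - residueSum ℓ (-1) ζ := by
    rw [hsub, gaussSum]
    exact Finset.sum_congr rfl fun a _ => by simp [AddChar.zmodChar_apply]
  rw [hG, MulChar.ringHomComp_apply, quadraticChar_neg_one hchar, ZMod.card] at hsq
  simp only [eq_intCast] at hsq
  linear_combination (residueSum ℓ 1 ζ + residueSum ℓ (-1) ζ - 1) * hadd - hsq

/-- The product of the two quadratic Gauss periods is the expected integer, over any domain. -/
lemma residueSum_mul [IsDomain R] (hℓ : ℓ ≠ 2) {c : ℤ} (hc : 4 * c = 1 - ZMod.χ₄ ℓ * ℓ)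
    {z : R} (hz : IsPrimitiveRoot z ℓ) (hR : (ℓ : R) ≠ 0) :
    residueSum ℓ 1 z * residueSum ℓ (-1) z = c := by
  have hp : ℓ.Prime := Fact.out
  have : NeZero (ℓ : R) := ⟨hR⟩
  have hζ := Complex.isPrimitiveRoot_exp ℓ hp.ne_zero
  set ζ := Complex.exp (2 * Real.pi * Complex.I / ℓ)
  have hroot : aeval ζ (residueSum ℓ 1 (X : ℤ[X]) * residueSum ℓ (-1) X - C c) = 0 := by
    have h4 := four_mul_residueSum_mul hℓ hζ
    have hc' : (4 : ℂ) * c = 1 - (ZMod.χ₄ ℓ : ℂ) * ℓ := by exact_mod_cast hc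
    rw [map_sub, map_mul]
    simp only [residueSum, map_sum, map_pow, aeval_X, eq_intCast, map_intCast] at h4 ⊢
    linear_combination (h4 - hc') / 4
  have hdvd : cyclotomic ℓ ℤ ∣ residueSum ℓ 1 (X : ℤ[X]) * residueSum ℓ (-1) X - C c := by
    rw [cyclotomic_eq_minpoly hζ hp.pos]
    exact minpoly.isIntegrallyClosed_dvd (hζ.isIntegral hp.pos) hroot
  have hz0 : aeval z (cyclotomic ℓ ℤ) = 0 := by
    have := hz.isRoot_cyclotomic hp.pos
    rwa [IsRoot.def, ← map_cyclotomic_int, eval_map, ← algebraMap_int_eq, ← aeval_def] at this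
  have := aeval_eq_zero_of_dvd_aeval_eq_zero hdvd hz0
  simp only [residueSum, map_sub, map_mul, map_sum, map_pow, aeval_X, eq_intCast, map_intCast] at this ⊢
  exact sub_eq_zero.mp this

end ResidueSums

lemma dvd_of_separable_of_roots {F K : Type*} [Field F] [Field K] [IsAlgClosed K] [Algebra F K]
    {D f : F[X]} (hD : D.Separable) (h : ∀ z : K, aeval z D = 0 → aeval z f = 0) : D ∣ f := by
  by_cases hf : f = 0
  · simp [hf]
  rw [← map_dvd_map' (algebraMap F K)]
  have hD0 : D.map (algebraMap F K) ≠ 0 :=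
    (Polynomial.map_ne_zero_iff (algebraMap F K).injective).mpr hD.ne_zero
  have hf0 : f.map (algebraMap F K) ≠ 0 :=
    (Polynomial.map_ne_zero_iff (algebraMap F K).injective).mpr hf
  refine (IsAlgClosed.splits _).dvd_of_roots_le_roots hD0 ?_
  rw [Multiset.le_iff_subset (nodup_roots hD.map)]
  intro z hz
  rw [mem_roots hD0, IsRoot.def, eval_map_algebraMap] at hz
  rw [mem_roots hf0, IsRoot.def, eval_map_algebraMap]
  exact h z hz

lemma gcd_eq_of_roots {F K : Type*} [Field F] [DecidableEq F] [Field K] [IsAlgClosed K]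
    [Algebra F K] {f g D : F[X]} (hf : f.Separable) (hD : D.Monic) (hDf : D ∣ f)
    (h : ∀ z : K, aeval z f = 0 → (aeval z g = 0 ↔ aeval z D = 0)) : gcd f g = D := by
  have hdvd : D ∣ g := dvd_of_separable_of_roots (K := K) (hf.of_dvd hDf) fun z hz =>
    (h z (aeval_eq_zero_of_dvd_aeval_eq_zero hDf hz)).mpr hz
  have hdvd' : gcd f g ∣ D :=
    dvd_of_separable_of_roots (K := K) (hf.of_dvd (gcd_dvd_left f g)) fun z hz =>
      (h z (aeval_eq_zero_of_dvd_aeval_eq_zero (gcd_dvd_left f g) hz)).mp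
        (aeval_eq_zero_of_dvd_aeval_eq_zero (gcd_dvd_right f g) hz)
  have := normalize_eq_normalize hdvd' (dvd_gcd hDf hdvd)
  rwa [normalize_gcd, hD.normalize_eq_self] at this

lemma X_pow_sub_one_eq_cyclotomic {m₁ m₂ : ℕ} (h₁ : m₁.Prime) (h₂ : m₂.Prime) (hne : m₁ ≠ m₂)
    (R : Type*) [CommRing R] :
    (X ^ (m₁ * m₂) - 1 : R[X])
      = (X - 1) * cyclotomic m₁ R * cyclotomic m₂ R * cyclotomic (m₁ * m₂) R := by
  have : Fact m₁.Prime := ⟨h₁⟩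
  have : Fact m₂.Prime := ⟨h₂⟩
  have hexp : (X ^ (m₁ * m₂) - 1 : R[X]) = expand R m₂ (X ^ m₁ - 1) := by
    simp [← pow_mul, mul_comm]
  have hX : expand R m₂ (X - 1) = X ^ m₂ - 1 := by simp
  rw [hexp, ← cyclotomic_prime_mul_X_sub_one R m₁, map_mul, hX,
    cyclotomic_expand_eq_cyclotomic_mul h₂ fun h => hne ((Nat.prime_dvd_prime_iff_eq h₂ h₁).mp h).symm,
    ← cyclotomic_prime_mul_X_sub_one R m₂]
  ring

section ChineseRemainder

variable {n₁ n₂ : ℕ} [Fact n₁.Prime] [Fact n₂.Prime]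

lemma sum_pow_val_eq_residueSum {R : Type*} [CommRing R] (hne : n₁ ≠ n₂)
    {C : Finset (ZMod (n₁ * n₂))}
    (hC : ∀ x, x ∈ C ↔ (x.val : ZMod n₁) = 0 ∧ (x.val : ZMod n₂) ≠ 0 ∨
      quadraticChar (ZMod n₁) x.val * quadraticChar (ZMod n₂) x.val = -1)
    {z₁ z₂ : R} (hz₁ : z₁ ^ n₁ = 1) (hz₂ : z₂ ^ n₂ = 1) :
    ∑ x ∈ C, (z₁ * z₂) ^ x.val = residueSum n₂ 1 z₂ + residueSum n₂ (-1) z₂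
      + residueSum n₁ 1 z₁ * residueSum n₂ (-1) z₂
      + residueSum n₁ (-1) z₁ * residueSum n₂ 1 z₂ := by
  have hp₁ : n₁.Prime := Fact.out
  have hp₂ : n₂.Prime := Fact.out
  have : NeZero (n₁ * n₂) := ⟨(Nat.mul_pos hp₁.pos hp₂.pos).ne'⟩
  let φ := ZMod.chineseRemainder ((Nat.coprime_primes hp₁ hp₂).mpr hne)
  have hφ : ∀ x, φ x = ((x.val : ZMod n₁), (x.val : ZMod n₂)) := by
    intro x
    conv_lhs => rw [← ZMod.natCast_zmod_val x]
    rw [map_natCast]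
    rfl
  let w : ZMod n₁ → ZMod n₂ → R := fun a b => z₁ ^ a.val * z₂ ^ b.val
  have hsum : ∑ x ∈ C, (z₁ * z₂) ^ x.val = ∑ y : ZMod n₁ × ZMod n₂,
      if y.1 = 0 ∧ y.2 ≠ 0 ∨ quadraticChar (ZMod n₁) y.1 * quadraticChar (ZMod n₂) y.2 = -1
      then w y.1 y.2 else 0 := by
    rw [← Finset.filter_univ_mem C, Finset.sum_filter]
    refine Fintype.sum_equiv φ.toEquiv _ _ fun x => ?_
    have : φ.toEquiv x = ((x.val : ZMod n₁), (x.val : ZMod n₂)) := hφ x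
    simp only [this, hC, w, mul_pow, ZMod.val_natCast]
    rw [pow_eq_pow_mod x.val hz₁, pow_eq_pow_mod x.val hz₂]
  have hterm : ∀ a b,
      (if a = 0 ∧ b ≠ 0 ∨ quadraticChar (ZMod n₁) a * quadraticChar (ZMod n₂) b = -1
        then w a b else 0)
      = (if a = 0 then (1 : R) else 0) * (if quadraticChar (ZMod n₂) b = 1 then z₂ ^ b.val else 0)
      + (if a = 0 then (1 : R) else 0) * (if quadraticChar (ZMod n₂) b = -1 then z₂ ^ b.val else 0)
      + (if quadraticChar (ZMod n₁) a = 1 then z₁ ^ a.val else 0)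
        * (if quadraticChar (ZMod n₂) b = -1 then z₂ ^ b.val else 0)
      + (if quadraticChar (ZMod n₁) a = -1 then z₁ ^ a.val else 0)
        * (if quadraticChar (ZMod n₂) b = 1 then z₂ ^ b.val else 0) := by
    intro a b
    by_cases ha : a = 0
    · by_cases hb : b = 0
      · simp [ha, hb]
      · rcases quadraticChar_dichotomy hb with h | h <;> simp [ha, hb, h, w]
    · by_cases hb : b = 0
      · simp [hb]
      · rcases quadraticChar_dichotomy ha with h | h <;>
          rcases quadraticChar_dichotomy hb with h' | h' <;> simp [ha, hb, h, h', w]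
  rw [hsum, Fintype.sum_prod_type]
  simp only [hterm, Finset.sum_add_distrib, ← Finset.mul_sum, ← Finset.sum_mul, residueSum,
    Finset.sum_filter, Finset.sum_ite_eq', Finset.mem_univ, if_true, one_mul]

end ChineseRemainder

lemma exists_mul_eq_of_pow_mul_eq_one {M : Type*} [CommMonoid M] {m₁ m₂ : ℕ} (h : m₁.Coprime m₂)
    {z : M} (hz : z ^ (m₁ * m₂) = 1) :
    ∃ z₁ z₂ : M, z₁ ^ m₁ = 1 ∧ z₂ ^ m₂ = 1 ∧ z = z₁ * z₂ := by
  obtain ⟨k, hk₁, hk₂⟩ := Nat.chineseRemainder h 1 0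
  obtain ⟨l, hl₁, hl₂⟩ := Nat.chineseRemainder h 0 1
  refine ⟨z ^ k, z ^ l, ?_, ?_, ?_⟩
  · obtain ⟨c, hc⟩ := (Nat.modEq_zero_iff_dvd.mp hk₂)
    rw [← pow_mul, hc, show m₂ * c * m₁ = m₁ * m₂ * c by ring, pow_mul, hz, one_pow]
  · obtain ⟨c, hc⟩ := (Nat.modEq_zero_iff_dvd.mp hl₁)
    rw [← pow_mul, hc, show m₁ * c * m₂ = m₁ * m₂ * c by ring, pow_mul, hz, one_pow]
  · have hmod : k + l ≡ 1 [MOD m₁ * m₂] :=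
      (Nat.modEq_and_modEq_iff_modEq_mul h).mp ⟨hk₁.add hl₁, hk₂.add hl₂⟩
    rw [← pow_add, pow_eq_pow_mod _ hz, hmod, ← pow_eq_pow_mod _ hz, pow_one]

lemma exists_four_mul_eq {ℓ : ℕ} (hℓ : Odd ℓ) : ∃ c : ℤ, 4 * c = 1 - ZMod.χ₄ ℓ * ℓ := by
  have : ℓ % 4 = 1 ∨ ℓ % 4 = 3 := by grind
  rcases this with h | h
  · rw [ZMod.χ₄_nat_one_mod_four h]
    exact ⟨(1 - ℓ) / 4, by omega⟩
  · rw [ZMod.χ₄_nat_three_mod_four h]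
    exact ⟨(1 + ℓ) / 4, by omega⟩

/-- The sum that controls primitive `n₁ * n₂`-th roots of unity does not vanish. -/
lemma residueSum_combination_ne_zero {n₁ n₂ p : ℕ} [Fact n₁.Prime] [Fact n₂.Prime]
    {K : Type*} [Field K] [CharP K p] (hodd₁ : Odd n₁) (hodd₂ : Odd n₂)
    (hK₁ : (n₁ : K) ≠ 0) (hK₂ : (n₂ : K) ≠ 0)
    (hcase : ((n₁ * n₂) % 12 = 7 ∧ ¬ p ∣ (n₁ * n₂ + 1) / 4) ∨
      ((n₁ * n₂) % 12 = 1 ∧ ¬ p ∣ (n₁ * n₂ - 1) / 4))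
    {z₁ z₂ : K} (hz₁ : z₁ ^ n₁ = 1) (hz₂ : z₂ ^ n₂ = 1) (h₁ : z₁ ≠ 1) (h₂ : z₂ ≠ 1) :
    residueSum n₂ 1 z₂ + residueSum n₂ (-1) z₂
      + residueSum n₁ 1 z₁ * residueSum n₂ (-1) z₂
      + residueSum n₁ (-1) z₁ * residueSum n₂ 1 z₂ ≠ 0 := by
  intro h
  obtain ⟨c₁, hc₁⟩ := exists_four_mul_eq hodd₁
  obtain ⟨c₂, hc₂⟩ := exists_four_mul_eq hodd₂
  have hprim₁ : IsPrimitiveRoot z₁ n₁ := (orderOf_eq_prime hz₁ h₁) ▸ IsPrimitiveRoot.orderOf z₁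
  have hprim₂ : IsPrimitiveRoot z₂ n₂ := (orderOf_eq_prime hz₂ h₂) ▸ IsPrimitiveRoot.orderOf z₂
  have m₁ := residueSum_mul (by rintro rfl; exact absurd hodd₁ (by decide)) hc₁ hprim₁ hK₁
  have m₂ := residueSum_mul (by rintro rfl; exact absurd hodd₂ (by decide)) hc₂ hprim₂ hK₂
  have a₁ := residueSum_add_of_ne_one hz₁ h₁
  have a₂ := residueSum_add_of_ne_one hz₂ h₂
  generalize residueSum n₁ 1 z₁ = A₁ at *
  generalize residueSum n₁ (-1) z₁ = B₁ at *
  generalize residueSum n₂ 1 z₂ = A₂ at *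
  generalize residueSum n₂ (-1) z₂ = B₂ at *
  have hd : ((c₁ + c₂ - 4 * c₁ * c₂ : ℤ) : K) = 0 := by
    push_cast
    rw [← m₁, ← m₂]
    obtain rfl : B₁ = -1 - A₁ := by linear_combination a₁
    obtain rfl : B₂ = -1 - A₂ := by linear_combination a₂
    linear_combination (A₁ * A₂ + (-1 - A₁) * (-1 - A₂) - 1) * h
  rw [CharP.intCast_eq_zero_iff K p] at hd
  have h4 : 4 * (c₁ + c₂ - 4 * c₁ * c₂) = 1 - ZMod.χ₄ ((n₁ * n₂ : ℕ) : ZMod 4) * (n₁ * n₂ : ℕ) := by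
    push_cast
    rw [map_mul]
    linear_combination (1 - 4 * c₂) * hc₁ + ZMod.χ₄ n₁ * n₁ * hc₂
  generalize n₁ * n₂ = n at *
  rcases hcase with ⟨hn, hp⟩ | ⟨hn, hp⟩
  · rw [ZMod.χ₄_nat_three_mod_four (by omega)] at h4
    refine hp (Int.natCast_dvd_natCast.mp ?_)
    convert hd using 1
    omega
  · rw [ZMod.χ₄_nat_one_mod_four (by omega)] at h4
    refine hp (Int.natCast_dvd_natCast.mp ?_)
    rwa [show (((n - 1) / 4 : ℕ) : ℤ) = -(c₁ + c₂ - 4 * c₁ * c₂) by omega, dvd_neg]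

lemma quadraticChar_eq_neg_one_of_orderOf {ℓ : ℕ} [Fact ℓ.Prime] (hℓ : Odd ℓ) {g : ZMod ℓ}
    (hg : orderOf g = ℓ - 1) : quadraticChar (ZMod ℓ) g = -1 := by
  have hp : ℓ.Prime := Fact.out
  rw [quadraticChar_neg_one_iff_not_isSquare]
  rintro ⟨b, rfl⟩
  have h2 := hp.two_le
  obtain ⟨m, rfl⟩ := hℓ
  have hb : b ≠ 0 := by
    rintro rfl
    rw [mul_zero, orderOf_zero] at hg
    omega
  have h1 := ZMod.pow_card_sub_one_eq_one hb
  have hd := orderOf_dvd_of_pow_eq_one (x := b * b) (n := m) (by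
    rw [← h1, ← sq, ← pow_mul]
    congr 1)
  have := Nat.le_of_dvd (by omega) hd
  omega

lemma exists_pow_eq_of_orderOf {ℓ : ℕ} [Fact ℓ.Prime] {g x : ZMod ℓ}
    (hg : orderOf g = ℓ - 1) (hx : x ≠ 0) : ∃ k, g ^ k = x := by
  have hp : ℓ.Prime := Fact.out
  have : NeZero (ℓ - 1) := ⟨by have := hp.two_le; omega⟩
  have hprim : IsPrimitiveRoot g (ℓ - 1) := hg ▸ IsPrimitiveRoot.orderOf g
  obtain ⟨k, -, hk⟩ := hprim.eq_pow_of_pow_eq_one (ZMod.pow_card_sub_one_eq_one hx)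
  exact ⟨k, hk⟩

section Classes

variable {n₁ n₂ : ℕ} [Fact n₁.Prime] [Fact n₂.Prime]

lemma natCast_val_left (x : ZMod (n₁ * n₂)) :
    (x.val : ZMod n₁) = ZMod.castHom (dvd_mul_right n₁ n₂) (ZMod n₁) x := by
  have : NeZero (n₁ * n₂) := ⟨mul_ne_zero (NeZero.ne n₁) (NeZero.ne n₂)⟩
  rw [ZMod.natCast_val, ZMod.castHom_apply]

lemma natCast_val_right (x : ZMod (n₁ * n₂)) :
    (x.val : ZMod n₂) = ZMod.castHom (dvd_mul_left n₂ n₁) (ZMod n₂) x := by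
  have : NeZero (n₁ * n₂) := ⟨mul_ne_zero (NeZero.ne n₁) (NeZero.ne n₂)⟩
  rw [ZMod.natCast_val, ZMod.castHom_apply]

lemma eq_of_natCast_val_eq (h : n₁.Coprime n₂) {x y : ZMod (n₁ * n₂)}
    (h₁ : (x.val : ZMod n₁) = y.val) (h₂ : (x.val : ZMod n₂) = y.val) : x = y := by
  have : NeZero (n₁ * n₂) := ⟨mul_ne_zero (NeZero.ne n₁) (NeZero.ne n₂)⟩
  rw [ZMod.natCast_eq_natCast_iff] at h₁ h₂
  have := (Nat.modEq_and_modEq_iff_modEq_mul h).mp ⟨h₁, h₂⟩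
  rwa [← ZMod.natCast_eq_natCast_iff, ZMod.natCast_zmod_val, ZMod.natCast_zmod_val] at this

lemma exists_mul_natCast_iff (hne : n₁ ≠ n₂) (x : ZMod (n₁ * n₂)) :
    (∃ k : ℕ, 1 ≤ k ∧ k ≤ n₂ - 1 ∧ x = ((k * n₁ : ℕ) : ZMod (n₁ * n₂))) ↔
      (x.val : ZMod n₁) = 0 ∧ (x.val : ZMod n₂) ≠ 0 := by
  have hp₁ : n₁.Prime := Fact.out
  have hp₂ : n₂.Prime := Fact.out
  have : NeZero (n₁ * n₂) := ⟨mul_ne_zero (NeZero.ne n₁) (NeZero.ne n₂)⟩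
  have hpos := hp₂.pos
  rw [Ne, ZMod.natCast_eq_zero_iff, ZMod.natCast_eq_zero_iff]
  constructor
  · rintro ⟨k, hk, hk', rfl⟩
    have hlt : k * n₁ < n₁ * n₂ := by
      rw [mul_comm]
      exact Nat.mul_lt_mul_of_pos_left (by omega) hp₁.pos
    rw [ZMod.val_natCast_of_lt hlt]
    refine ⟨dvd_mul_left _ _, fun hd => ?_⟩
    rcases hp₂.dvd_mul.mp hd with h | h
    · have := Nat.le_of_dvd (by omega) h
      omega
    · exact hne ((Nat.prime_dvd_prime_iff_eq hp₂ hp₁).mp h).symm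
  · rintro ⟨⟨k, hk⟩, hx⟩
    have hlt := x.val_lt
    rw [hk] at hlt hx
    refine ⟨k, ?_, ?_, ?_⟩
    · rcases Nat.eq_zero_or_pos k with rfl | h
      · simp at hx
      · exact h
    · have := Nat.lt_of_mul_lt_mul_left hlt
      omega
    · have := (ZMod.natCast_zmod_val x).symm
      rwa [hk, mul_comm n₁ k] at this

lemma exists_odd_class_iff (hodd₁ : Odd n₁) (hodd₂ : Odd n₂) (hne : n₁ ≠ n₂)
    (h6 : Nat.gcd (n₁ - 1) (n₂ - 1) = 6) {g u : ℕ}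
    (hg₁ : orderOf (g : ZMod n₁) = n₁ - 1) (hg₂ : orderOf (g : ZMod n₂) = n₂ - 1)
    (hu₁ : (u : ZMod n₁) = (g : ZMod n₁)) (hu₂ : (u : ZMod n₂) = 1) (x : ZMod (n₁ * n₂)) :
    (∃ i, (i = 1 ∨ i = 3 ∨ i = 5) ∧ ∃ s < (n₁ - 1) * (n₂ - 1) / 6,
      x = (g : ZMod (n₁ * n₂)) ^ s * (u : ZMod (n₁ * n₂)) ^ i) ↔
      quadraticChar (ZMod n₁) x.val * quadraticChar (ZMod n₂) x.val = -1 := by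
  have hp₁ : n₁.Prime := Fact.out
  have hp₂ : n₂.Prime := Fact.out
  have hcop := (Nat.coprime_primes hp₁ hp₂).mpr hne
  have hχ₁ := quadraticChar_eq_neg_one_of_orderOf hodd₁ hg₁
  have hχ₂ := quadraticChar_eq_neg_one_of_orderOf hodd₂ hg₂
  have hval₁ : ∀ s i, ((((g : ZMod (n₁ * n₂)) ^ s * (u : ZMod (n₁ * n₂)) ^ i).val : ℕ) : ZMod n₁)
      = (g : ZMod n₁) ^ (s + i) := by
    intro s i
    rw [natCast_val_left, map_mul, map_pow, map_pow, map_natCast, map_natCast, hu₁, pow_add]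
  have hval₂ : ∀ s i, ((((g : ZMod (n₁ * n₂)) ^ s * (u : ZMod (n₁ * n₂)) ^ i).val : ℕ) : ZMod n₂)
      = (g : ZMod n₂) ^ s := by
    intro s i
    rw [natCast_val_right, map_mul, map_pow, map_pow, map_natCast, map_natCast, hu₂, one_pow,
      mul_one]
  constructor
  · rintro ⟨i, hi, s, -, rfl⟩
    rw [hval₁, hval₂, map_pow, map_pow, hχ₁, hχ₂, ← pow_add]
    refine Odd.neg_one_pow ?_
    rcases hi with rfl | rfl | rfl <;> grind
  · intro h
    have hx₁ : (x.val : ZMod n₁) ≠ 0 := by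
      intro h0
      simp [h0] at h
    have hx₂ : (x.val : ZMod n₂) ≠ 0 := by
      intro h0
      simp [h0] at h
    obtain ⟨r, hr⟩ := exists_pow_eq_of_orderOf hg₁ hx₁
    obtain ⟨t, ht⟩ := exists_pow_eq_of_orderOf hg₂ hx₂
    rw [← hr, ← ht, map_pow, map_pow, hχ₁, hχ₂, ← pow_add] at h
    have hrt : Odd (r + t) := by
      by_contra hev
      rw [Nat.not_odd_iff_even] at hev
      simp [hev.neg_one_pow] at h
    have hd₁ : 6 ∣ n₁ - 1 := h6 ▸ Nat.gcd_dvd_left _ _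
    have hpos₁ := hp₁.two_le
    have hpos₂ := hp₂.two_le
    obtain ⟨m, hm⟩ := hd₁
    set i := (r + 5 * t) % 6 with hi
    have hmod : r + (n₁ - 2) * i ≡ t [MOD Nat.gcd (n₁ - 1) (n₂ - 1)] := by
      rw [h6, show n₁ - 2 = 6 * (m - 1) + 5 by omega, add_mul, mul_assoc]
      unfold Nat.ModEq
      omega
    have hlt := Nat.chineseRemainder'_lt_lcm hmod (by omega) (by omega)
    rw [Nat.lcm, h6] at hlt
    generalize Nat.chineseRemainder' hmod = s at hlt
    obtain ⟨s, hs₁, hs₂⟩ := s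
    refine ⟨i, by grind, s, hlt, eq_of_natCast_val_eq hcop ?_ ?_⟩
    · rw [hval₁, ← hr]
      have h₁ := hs₁.add_right i
      have h₂ : r + (n₁ - 2) * i + i = r + (n₁ - 1) * i := by
        rw [show n₁ - 1 = n₁ - 2 + 1 by omega]
        ring
      rw [h₂] at h₁
      exact pow_eq_pow_of_modEq (h₁.trans (by simp [Nat.ModEq])).symm (hg₁ ▸ pow_orderOf_eq_one _)
    · rw [hval₂, ← ht]
      exact pow_eq_pow_of_modEq hs₂.symm (hg₂ ▸ pow_orderOf_eq_one _)

end Classes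

lemma eq_one_of_pow_eq_one_of_coprime {M : Type*} [Monoid M] {m₁ m₂ : ℕ} (h : m₁.Coprime m₂)
    {z : M} (h₁ : z ^ m₁ = 1) (h₂ : z ^ m₂ = 1) : z = 1 := by
  have := pow_gcd_eq_one.mpr ⟨h₁, h₂⟩
  rwa [h, pow_one] at this

lemma aeval_mul_X_pow_sub_one_eq_zero_iff {F K : Type*} [Field F] [Field K] [Algebra F K]
    {m₁ m₂ : ℕ} (h : m₁.Coprime m₂) {z₁ z₂ : K} (h₁ : z₁ ^ m₁ = 1) (h₂ : z₂ ^ m₂ = 1) :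
    aeval (z₁ * z₂) (X ^ m₁ - 1 : F[X]) = 0 ↔ z₂ = 1 := by
  rw [map_sub, map_pow, aeval_X, map_one, sub_eq_zero, mul_pow, h₁, one_mul]
  exact ⟨fun h' => eq_one_of_pow_eq_one_of_coprime h h' h₂, fun h' => by rw [h', one_pow]⟩

lemma aeval_mul_X_sub_one_eq_zero_iff {F K : Type*} [Field F] [Field K] [Algebra F K]
    {m₁ m₂ : ℕ} (h : m₁.Coprime m₂) {z₁ z₂ : K} (h₁ : z₁ ^ m₁ = 1) (h₂ : z₂ ^ m₂ = 1) :
    aeval (z₁ * z₂) (X - 1 : F[X]) = 0 ↔ z₁ = 1 ∧ z₂ = 1 := by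
  rw [map_sub, aeval_X, map_one, sub_eq_zero]
  refine ⟨fun h' => ?_, fun ⟨h₁', h₂'⟩ => by rw [h₁', h₂', one_mul]⟩
  have hz₂ : z₂ = 1 := by
    refine eq_one_of_pow_eq_one_of_coprime h ?_ h₂
    rw [← one_mul (z₂ ^ m₁), ← h₁, ← mul_pow, h', one_pow, h₁]
  exact ⟨by rwa [hz₂, mul_one] at h', hz₂⟩

/-- The roots of the generalized cyclotomic polynomial among products of roots of unity. -/
lemma residueSum_combination_eq_zero_iff {n₁ n₂ p : ℕ} [Fact n₁.Prime] [Fact n₂.Prime]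
    {K : Type*} [Field K] [CharP K p] (hodd₁ : Odd n₁) (hodd₂ : Odd n₂)
    (hK₁ : (n₁ : K) ≠ 0) (hK₂ : (n₂ : K) ≠ 0)
    (hcase : ((n₁ * n₂) % 12 = 7 ∧ ¬ p ∣ (n₁ * n₂ + 1) / 4) ∨
      ((n₁ * n₂) % 12 = 1 ∧ ¬ p ∣ (n₁ * n₂ - 1) / 4))
    {z₁ z₂ : K} (hz₁ : z₁ ^ n₁ = 1) (hz₂ : z₂ ^ n₂ = 1) :
    residueSum n₂ 1 z₂ + residueSum n₂ (-1) z₂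
      + residueSum n₁ 1 z₁ * residueSum n₂ (-1) z₂
      + residueSum n₁ (-1) z₁ * residueSum n₂ 1 z₂ = 0 ↔
    z₁ = 1 ∧ z₂ = 1 ∧ (((n₁ + 1) * (n₂ - 1) / 2 : ℕ) : K) = 0 ∨
      z₁ ≠ 1 ∧ z₂ = 1 ∧ (((n₂ - 1) / 2 : ℕ) : K) = 0 ∨
      z₁ = 1 ∧ z₂ ≠ 1 ∧ (((n₁ + 1) / 2 : ℕ) : K) = 0 := by
  have h2₁ : n₁ ≠ 2 := by
    rintro rfl
    exact absurd hodd₁ (by decide)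
  have h2₂ : n₂ ≠ 2 := by
    rintro rfl
    exact absurd hodd₂ (by decide)
  by_cases h₁ : z₁ = 1 <;> by_cases h₂ : z₂ = 1
  · subst h₁ h₂
    obtain ⟨k₁, hk₁⟩ := hodd₁
    obtain ⟨k₂, hk₂⟩ := hodd₂
    have hd : (n₁ + 1) * (n₂ - 1) / 2 = 2 * (k₁ + 1) * k₂ := by
      rw [show n₁ + 1 = 2 * (k₁ + 1) by omega, show n₂ - 1 = 2 * k₂ by omega, mul_assoc,
        Nat.mul_div_cancel_left _ two_pos]
      ring
    rw [residueSum_one h2₁ (.inl rfl), residueSum_one h2₁ (.inr rfl),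
      residueSum_one h2₂ (.inl rfl), residueSum_one h2₂ (.inr rfl), hd,
      show (n₁ - 1) / 2 = k₁ by omega, show (n₂ - 1) / 2 = k₂ by omega]
    simp only [ne_eq, not_true_eq_false, false_and, and_false, or_false, true_and]
    apply Eq.congr_left
    push_cast
    ring
  · subst h₁
    have hd₁ : (n₁ + 1) / 2 = (n₁ - 1) / 2 + 1 := by grind
    rw [residueSum_one h2₁ (.inl rfl), residueSum_one h2₁ (.inr rfl), hd₁]
    simp only [h₂, ne_eq, not_true_eq_false, not_false_eq_true, false_and, and_false, false_or,
      true_and]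
    rw [← neg_eq_zero]
    apply Eq.congr_left
    push_cast
    linear_combination
      -(1 + ((n₁ - 1) / 2 : ℕ) : K) * residueSum_add_of_ne_one hz₂ h₂
  · subst h₂
    rw [residueSum_one h2₂ (.inl rfl), residueSum_one h2₂ (.inr rfl)]
    simp only [h₁, ne_eq, not_true_eq_false, not_false_eq_true, false_and, and_false, false_or,
      or_false, true_and]
    apply Eq.congr_left
    linear_combination (((n₂ - 1) / 2 : ℕ) : K) * residueSum_add_of_ne_one hz₁ h₁
  · have := residueSum_combination_ne_zero hodd₁ hodd₂ hK₁ hK₂ hcase hz₁ hz₂ h₁ h₂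
    simp only [this, h₁, h₂, ne_eq, false_and, and_false, or_false]

lemma gcd_X_pow_mul_sub_one_eq {F K : Type*} [Field F] [DecidableEq F] [Field K] [IsAlgClosed K]
    [Algebra F K] {m₁ m₂ : ℕ} (hcop : m₁.Coprime m₂) (hF : ((m₁ * m₂ : ℕ) : F) ≠ 0)
    {f D : F[X]} (hD : D.Monic) (hdvd : D ∣ X ^ (m₁ * m₂) - 1)
    (h : ∀ z₁ z₂ : K, z₁ ^ m₁ = 1 → z₂ ^ m₂ = 1 →
      (aeval (z₁ * z₂) f = 0 ↔ aeval (z₁ * z₂) D = 0)) :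
    gcd (X ^ (m₁ * m₂) - 1) f = D := by
  refine gcd_eq_of_roots (K := K) (X_pow_sub_one_separable_iff.mpr hF) hD hdvd fun z hz => ?_
  rw [map_sub, map_pow, aeval_X, map_one, sub_eq_zero] at hz
  obtain ⟨z₁, z₂, hz₁, hz₂, rfl⟩ := exists_mul_eq_of_pow_mul_eq_one hcop hz
  exact h z₁ z₂ hz₁ hz₂

/-- The possible greatest common divisors with `X ^ (n₁ * n₂) - 1`, from the set of common roots. -/
lemma gcd_cases {F K : Type*} [Field F] [DecidableEq F] [Field K] [IsAlgClosed K]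
    [Algebra F K] {n₁ n₂ : ℕ} (hp₁ : n₁.Prime) (hp₂ : n₂.Prime) (hne : n₁ ≠ n₂)
    (hF : ((n₁ * n₂ : ℕ) : F) ≠ 0) {f : F[X]} {A₁ A₂ A : Prop} (hA : A₁ ∨ A₂ → A)
    (h : ∀ z₁ z₂ : K, z₁ ^ n₁ = 1 → z₂ ^ n₂ = 1 →
      (aeval (z₁ * z₂) f = 0 ↔
        z₁ = 1 ∧ z₂ = 1 ∧ A ∨ z₁ ≠ 1 ∧ z₂ = 1 ∧ A₂ ∨ z₁ = 1 ∧ z₂ ≠ 1 ∧ A₁)) :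
    (¬ A₁ ∧ ¬ A₂ ∧ ¬ A → gcd (X ^ (n₁ * n₂) - 1) f = 1) ∧
    (¬ A₁ ∧ ¬ A₂ ∧ A → gcd (X ^ (n₁ * n₂) - 1) f = X - 1) ∧
    (A₁ ∧ ¬ A₂ → gcd (X ^ (n₁ * n₂) - 1) f = X ^ n₂ - 1) ∧
    (¬ A₁ ∧ A₂ → gcd (X ^ (n₁ * n₂) - 1) f = X ^ n₁ - 1) ∧
    (A₁ ∧ A₂ → gcd (X ^ (n₁ * n₂) - 1) f = (X - 1) * cyclotomic n₁ F * cyclotomic n₂ F) := by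
  have : Fact n₁.Prime := ⟨hp₁⟩
  have : Fact n₂.Prime := ⟨hp₂⟩
  have hcop := (Nat.coprime_primes hp₁ hp₂).mpr hne
  have hmonic : (X - 1 : F[X]).Monic := monic_X_sub_C 1
  have hX₁ := cyclotomic_prime_mul_X_sub_one F n₁
  have hX₂ := cyclotomic_prime_mul_X_sub_one F n₂
  have hroot₁ : ∀ z₁ z₂ : K, z₁ ^ n₁ = 1 → z₂ ^ n₂ = 1 →
      (aeval (z₁ * z₂) (X ^ n₁ - 1 : F[X]) = 0 ↔ z₂ = 1) := fun z₁ z₂ hz₁ hz₂ =>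
    aeval_mul_X_pow_sub_one_eq_zero_iff hcop hz₁ hz₂
  have hroot₂ : ∀ z₁ z₂ : K, z₁ ^ n₁ = 1 → z₂ ^ n₂ = 1 →
      (aeval (z₁ * z₂) (X ^ n₂ - 1 : F[X]) = 0 ↔ z₁ = 1) := fun z₁ z₂ hz₁ hz₂ => by
    rw [mul_comm]
    exact aeval_mul_X_pow_sub_one_eq_zero_iff hcop.symm hz₂ hz₁
  refine ⟨?_, ?_, ?_, ?_, ?_⟩
  · rintro ⟨h₁, h₂, h₀⟩
    refine gcd_X_pow_mul_sub_one_eq (K := K) hcop hF monic_one (one_dvd _) fun z₁ z₂ hz₁ hz₂ => ?_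
    rw [h z₁ z₂ hz₁ hz₂, map_one]
    simp [h₁, h₂, h₀]
  · rintro ⟨h₁, h₂, h₀⟩
    refine gcd_X_pow_mul_sub_one_eq (K := K) hcop hF hmonic (sub_one_dvd_pow_sub_one X _)
      fun z₁ z₂ hz₁ hz₂ => ?_
    rw [h z₁ z₂ hz₁ hz₂, aeval_mul_X_sub_one_eq_zero_iff hcop hz₁ hz₂]
    simp [h₁, h₂, h₀]
  · rintro ⟨h₁, h₂⟩
    refine gcd_X_pow_mul_sub_one_eq (K := K) hcop hF (monic_X_pow_sub_C 1 hp₂.ne_zero)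
      (by rw [mul_comm, pow_mul]; exact sub_one_dvd_pow_sub_one _ n₁) fun z₁ z₂ hz₁ hz₂ => ?_
    rw [h z₁ z₂ hz₁ hz₂, hroot₂ z₁ z₂ hz₁ hz₂]
    have h₀ := hA (.inl h₁)
    simp only [h₁, h₂, h₀]
    tauto
  · rintro ⟨h₁, h₂⟩
    refine gcd_X_pow_mul_sub_one_eq (K := K) hcop hF (monic_X_pow_sub_C 1 hp₁.ne_zero)
      (by rw [pow_mul]; exact sub_one_dvd_pow_sub_one _ n₂) fun z₁ z₂ hz₁ hz₂ => ?_
    rw [h z₁ z₂ hz₁ hz₂, hroot₁ z₁ z₂ hz₁ hz₂]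
    have h₀ := hA (.inr h₂)
    simp only [h₁, h₂, h₀]
    tauto
  · rintro ⟨h₁, h₂⟩
    refine gcd_X_pow_mul_sub_one_eq (K := K) hcop hF
      ((hmonic.mul (cyclotomic.monic n₁ F)).mul (cyclotomic.monic n₂ F))
      ⟨_, X_pow_sub_one_eq_cyclotomic hp₁ hp₂ hne F⟩ fun z₁ z₂ hz₁ hz₂ => ?_
    have hz : aeval (z₁ * z₂) ((X - 1) * cyclotomic n₁ F * cyclotomic n₂ F) = 0 ↔
        z₁ = 1 ∨ z₂ = 1 := by
      rw [← hroot₁ z₁ z₂ hz₁ hz₂, ← hroot₂ z₁ z₂ hz₁ hz₂, ← hX₁, ← hX₂]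
      simp only [map_mul, mul_eq_zero]
      tauto
    rw [h z₁ z₂ hz₁ hz₂, hz]
    have h₀ := hA (.inl h₁)
    simp only [h₁, h₂, h₀]
    tauto

theorem stmt_14
    (n₁ n₂ n e g u : ℕ)
    (hp₁ : n₁.Prime) (hp₂ : n₂.Prime)
    (hodd₁ : Odd n₁) (hodd₂ : Odd n₂) (hne : n₁ ≠ n₂)
    (h6 : Nat.gcd (n₁ - 1) (n₂ - 1) = 6)
    (hn : n = n₁ * n₂)
    (he : e = (n₁ - 1) * (n₂ - 1) / 6)
    (hg₁ : orderOf (g : ZMod n₁) = n₁ - 1)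
    (hg₂ : orderOf (g : ZMod n₂) = n₂ - 1)
    (hu₁ : (u : ZMod n₁) = (g : ZMod n₁))
    (hu₂ : (u : ZMod n₂) = 1)
    (W : ℕ → Finset (ZMod n))
    (hW : ∀ i, (W i : Set (ZMod n)) =
      {x | ∃ s < e, x = (g : ZMod n) ^ s * (u : ZMod n) ^ i})
    (P Q : Set (ZMod n))
    (hP : P = {x | ∃ k : ℕ, 1 ≤ k ∧ k ≤ n₂ - 1 ∧ x = ((k * n₁ : ℕ) : ZMod n)})
    (hQ : Q = {x | ∃ k : ℕ, 1 ≤ k ∧ k ≤ n₁ - 1 ∧ x = ((k * n₂ : ℕ) : ZMod n)})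
    (p a q : ℕ) (hp : p.Prime) (ha : 0 < a) (hq : q = p ^ a)
    (hco : Nat.Coprime n q)
    (F : Type) [Field F] [Fintype F] [DecidableEq F] [CharP F p]
    (hF : Fintype.card F = q)
    (hcase : (n % 12 = 7 ∧ ¬ p ∣ (n + 1) / 4) ∨ (n % 12 = 1 ∧ ¬ p ∣ (n - 1) / 4))
    (C₁ : Finset (ZMod n))
    (hC₁ : (C₁ : Set (ZMod n)) = P ∪ ↑(W 1) ∪ ↑(W 3) ∪ ↑(W 5))
    (Λ : Polynomial F) (hΛ : Λ = ∑ i ∈ C₁, X ^ i.val)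
    (G : Polynomial F) (hG : G = (X ^ n - 1) / gcd (X ^ n - 1) Λ)
    (L : ℕ) (hL : L = n - (gcd (X ^ n - 1 : Polynomial F) Λ).natDegree)
    (Δ₁ Δ₂ Δ : ZMod p)
    (hΔ₁ : Δ₁ = (((n₁ + 1) / 2 : ℕ) : ZMod p))
    (hΔ₂ : Δ₂ = (((n₂ - 1) / 2 : ℕ) : ZMod p))
    (hΔ : Δ = (((n₁ + 1) * (n₂ - 1) / 2 : ℕ) : ZMod p)) :
    ((Δ₁ ≠ 0 ∧ Δ₂ ≠ 0 ∧ Δ ≠ 0) → G = X ^ n - 1 ∧ L = n) ∧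
    ((Δ₁ ≠ 0 ∧ Δ₂ ≠ 0 ∧ Δ = 0) → G * (X - 1) = X ^ n - 1 ∧ L = n - 1) ∧
    ((Δ₁ = 0 ∧ Δ₂ ≠ 0) → G * (X ^ n₂ - 1) = X ^ n - 1 ∧ L = n - n₂) ∧
    ((Δ₁ ≠ 0 ∧ Δ₂ = 0) → G * (X ^ n₁ - 1) = X ^ n - 1 ∧ L = n - n₁) ∧
    ((Δ₁ = 0 ∧ Δ₂ = 0) →
      G * ((X ^ n₁ - 1) * (X ^ n₂ - 1)) = (X ^ n - 1) * (X - 1) ∧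
      L = n - (n₁ + n₂ - 1)) := by
  subst hn hΛ
  have : Fact n₁.Prime := ⟨hp₁⟩
  have : Fact n₂.Prime := ⟨hp₂⟩
  have hpn : ¬ p ∣ n₁ * n₂ := by
    rw [← hp.coprime_iff_not_dvd]
    rw [hq, Nat.coprime_pow_right_iff ha] at hco
    exact hco.symm
  have hchar : CharP (AlgebraicClosure F) p :=
    charP_of_injective_algebraMap (algebraMap F (AlgebraicClosure F)).injective p
  have hmem : ∀ x, x ∈ C₁ ↔ (x.val : ZMod n₁) = 0 ∧ (x.val : ZMod n₂) ≠ 0 ∨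
      quadraticChar (ZMod n₁) x.val * quadraticChar (ZMod n₂) x.val = -1 := by
    intro x
    rw [← exists_mul_natCast_iff hne x,
      ← exists_odd_class_iff hodd₁ hodd₂ hne h6 hg₁ hg₂ hu₁ hu₂ x, ← Finset.mem_coe, hC₁, hP,
      hW, hW, hW, he]
    simp only [Set.mem_union, Set.mem_ofPred_eq, or_assoc, or_and_right, exists_or,
      exists_eq_left]
  have hzero : ∀ m : ℕ, (m : AlgebraicClosure F) = 0 ↔ (m : ZMod p) = 0 := fun m => by
    rw [CharP.cast_eq_zero_iff (AlgebraicClosure F) p, ZMod.natCast_eq_zero_iff]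
  have hroot : ∀ z₁ z₂ : AlgebraicClosure F, z₁ ^ n₁ = 1 → z₂ ^ n₂ = 1 →
      (aeval (z₁ * z₂) (∑ i ∈ C₁, X ^ i.val : F[X]) = 0 ↔
        z₁ = 1 ∧ z₂ = 1 ∧ Δ = 0 ∨ z₁ ≠ 1 ∧ z₂ = 1 ∧ Δ₂ = 0 ∨ z₁ = 1 ∧ z₂ ≠ 1 ∧ Δ₁ = 0) := by
    intro z₁ z₂ hz₁ hz₂
    rw [hΔ, hΔ₁, hΔ₂, ← hzero, ← hzero, ← hzero,
      ← residueSum_combination_eq_zero_iff hodd₁ hodd₂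
        (fun h => hpn (((CharP.cast_eq_zero_iff _ p _).mp h).mul_right _))
        (fun h => hpn (((CharP.cast_eq_zero_iff _ p _).mp h).mul_left _)) hcase hz₁ hz₂,
      ← sum_pow_val_eq_residueSum hne hmem hz₁ hz₂, map_sum]
    simp only [map_pow, aeval_X]
  have hΔ_zero : Δ₁ = 0 ∨ Δ₂ = 0 → Δ = 0 := by
    obtain ⟨k₁, hk₁⟩ := hodd₁
    obtain ⟨k₂, hk₂⟩ := hodd₂
    have hd : (n₁ + 1) * (n₂ - 1) / 2 = 2 * ((n₁ + 1) / 2) * ((n₂ - 1) / 2) := by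
      rw [show n₁ + 1 = 2 * (k₁ + 1) by omega, show n₂ - 1 = 2 * k₂ by omega,
        Nat.mul_div_cancel_left _ two_pos, Nat.mul_div_cancel_left _ two_pos, mul_assoc,
        Nat.mul_div_cancel_left _ two_pos]
      ring
    rw [hΔ₁, hΔ₂, hΔ, hd, Nat.cast_mul, Nat.cast_mul]
    rintro (h | h) <;> rw [h] <;> ring
  have hF₀ : ((n₁ * n₂ : ℕ) : F) ≠ 0 := by rwa [Ne, CharP.cast_eq_zero_iff F p]
  obtain ⟨c₁, c₂, c₃, c₄, c₅⟩ := gcd_cases hp₁ hp₂ hne hF₀ hΔ_zero hroot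
  have hfinal : ∀ D : F[X], D.Monic → gcd (X ^ (n₁ * n₂) - 1) (∑ i ∈ C₁, X ^ i.val) = D →
      G * D = X ^ (n₁ * n₂) - 1 ∧ L = n₁ * n₂ - D.natDegree := by
    rintro D hD rfl
    refine ⟨?_, hL⟩
    rw [hG, mul_comm]
    exact EuclideanDomain.mul_div_cancel' hD.ne_zero (gcd_dvd_left _ _)
  clear hG hL hroot hmem hC₁ hW hP hQ
  have hmonic : (X - 1 : F[X]).Monic := monic_X_sub_C 1
  have hdeg : (X - 1 : F[X]).natDegree = 1 := natDegree_X_sub_C 1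
  refine ⟨fun h => ?_, fun h => ?_, fun h => ?_, fun h => ?_, fun h => ?_⟩
  · have := hfinal 1 monic_one (c₁ h)
    rwa [mul_one, natDegree_one, Nat.sub_zero] at this
  · have := hfinal (X - 1) hmonic (c₂ h)
    rwa [hdeg] at this
  · have := hfinal (X ^ n₂ - 1) (monic_X_pow_sub_C 1 hp₂.ne_zero) (c₃ h)
    rwa [show (X ^ n₂ - 1 : F[X]).natDegree = n₂ from natDegree_X_pow_sub_C] at this
  · have := hfinal (X ^ n₁ - 1) (monic_X_pow_sub_C 1 hp₁.ne_zero) (c₄ h)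
    rwa [show (X ^ n₁ - 1 : F[X]).natDegree = n₁ from natDegree_X_pow_sub_C] at this
  · have hmonic' := hmonic.mul (cyclotomic.monic n₁ F)
    obtain ⟨hG, hL⟩ := hfinal _ (hmonic'.mul (cyclotomic.monic n₂ F)) (c₅ h)
    constructor
    · rw [← hG, ← cyclotomic_prime_mul_X_sub_one F n₁, ← cyclotomic_prime_mul_X_sub_one F n₂]
      ring
    · rw [hL, hmonic'.natDegree_mul (cyclotomic.monic n₂ F),
        hmonic.natDegree_mul (cyclotomic.monic n₁ F), natDegree_cyclotomic, natDegree_cyclotomic,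
        Nat.totient_prime hp₁, Nat.totient_prime hp₂, hdeg]
      have h₁ := hp₁.two_le
      have h₂ := hp₂.two_le
      congr 1
      omega
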